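/- Let J ∈ B(H) be an anti self-adjoint unitary operator on H = ℓ²(ℕ, ℍ), m ∈ 𝕊, and let T ∈ B(H) satisfy TJ = JT, with restriction T_+ := T|_{H_+^{Jm}} : H_+^{Jm} → H_+^{Jm}. Then T is Hilbert–Schmidt on H if and only if T_+ is Hilbert–Schmidt on H_+^{Jm}, and in that case their Hilbert–Schmidt norms coincide: ‖T‖₂ = ‖T_+‖₂. -/

import Mathlib

noncomputable section

open Quaternion Filter Topology

/-- The division ring `ℍ` of real quaternions. -/
abbrev Hq := Quaternion ℝ

/-- The quaternionic Hilbert space `H = ℓ²(ℕ, ℍ)`. -/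
abbrev Hsp := lp (fun _ : ℕ => Hq) 2

/-- Right scalar multiplication `x ↦ x · q` on `ℓ²(ℕ, ℍ)` (coordinatewise right
multiplication by the quaternion `q`). -/
def rsmul (q : Hq) (x : Hsp) : Hsp := MulOpposite.op q • x

/-- The quaternionic inner product `⟨x, y⟩ = ∑ₙ x̄ₙ yₙ`. -/
def qinner (x y : Hsp) : Hq := ∑' n, star (x n) * y n

/-- The set `𝕊` of unit imaginary quaternions. -/
def QS : Set Hq := {q | star q = -q ∧ ‖q‖ = 1}

/-- The slice complex plane `ℂ_m = {α + mβ : α, β ∈ ℝ}`. -/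
def sliceC (m : Hq) : Set Hq := {q | ∃ α β : ℝ, q = (α : Hq) + m * (β : Hq)}

/-- The closed upper half slice plane `ℂ_m⁺ = {α + mβ : α ∈ ℝ, β ≥ 0}`. -/
def sliceCplus (m : Hq) : Set Hq :=
  {q | ∃ α β : ℝ, 0 ≤ β ∧ q = (α : Hq) + m * (β : Hq)}

/-- `T : H → H` is a bounded right linear operator, i.e. `T ∈ B(H)`. -/
def IsBoundedRightLinear (T : Hsp → Hsp) : Prop :=
  (∀ x y, T (x + y) = T x + T y) ∧ (∀ q x, T (rsmul q x) = rsmul q (T x)) ∧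
    ∃ M : ℝ, ∀ x, ‖T x‖ ≤ M * ‖x‖

/-- `S` is the adjoint of the (bounded) operator `T`: `⟨y, Tx⟩ = ⟨Sy, x⟩` for all `x, y`. -/
def AdjointOf (T S : Hsp → Hsp) : Prop := ∀ x y, qinner y (T x) = qinner (S y) x

/-- `T` is anti self-adjoint: `T* = -T`. -/
def IsAntiSelfAdjoint (T : Hsp → Hsp) : Prop := AdjointOf T (fun x => -(T x))

/-- `T` is unitary: `T*T = TT* = I`. -/
def IsUnitaryOp (T : Hsp → Hsp) : Prop :=
  ∃ S, AdjointOf T S ∧ (∀ x, S (T x) = x) ∧ (∀ x, T (S x) = x)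

/-- The slice Hilbert space `H₊^{Jm} = {u ∈ H : Ju = um}`. -/
def Hplus (J : Hsp → Hsp) (m : Hq) : Set Hsp := {u | J u = rsmul m u}

/-- `H₋^{Jm} = {u ∈ H : Ju = -um}`. -/
def Hminus (J : Hsp → Hsp) (m : Hq) : Set Hsp := {u | J u = -(rsmul m u)}

/-- `e` is an orthonormal basis of the (closed subspace given by the) set `S`:
each `e r` lies in `S`, the `e r` are orthonormal, and every `x ∈ S` expands as
`x = ∑ᵣ (e r) ⟨e r, x⟩`. Taking `S = Set.univ` gives orthonormal bases of `H`. -/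
def IsONBasisOn (S : Set Hsp) (e : ℕ → Hsp) : Prop :=
  (∀ r, e r ∈ S) ∧ (∀ r s, qinner (e r) (e s) = if r = s then 1 else 0) ∧
    ∀ x ∈ S, HasSum (fun r => rsmul (qinner (e r) x) (e r)) x

/-- A (possibly unbounded) operator in `H`: a domain together with an assignment of
values (only the values on the domain are relevant). -/
structure QOp where
  dom : Set Hsp
  app : Hsp → Hsp

/-- The operator `T` is right linear: its domain is a right `ℍ`-submodule and `T`
is additive and right `ℍ`-homogeneous on it. -/
def QOp.IsRightLinear (T : QOp) : Prop :=
  (0 ∈ T.dom) ∧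
  (∀ x ∈ T.dom, ∀ y ∈ T.dom, x + y ∈ T.dom ∧ T.app (x + y) = T.app x + T.app y) ∧
  (∀ x ∈ T.dom, ∀ q : Hq, rsmul q x ∈ T.dom ∧ T.app (rsmul q x) = rsmul q (T.app x))

/-- `T` is densely defined. -/
def QOp.IsDenselyDefined (T : QOp) : Prop := Dense T.dom

/-- `T` is a closed operator: its graph is closed in `H × H`. -/
def QOp.IsClosedOp (T : QOp) : Prop :=
  IsClosed {p : Hsp × Hsp | p.1 ∈ T.dom ∧ p.2 = T.app p.1}

/-- `S` is the adjoint `T*` of `T`: the domain of `S` is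
`{y : x ↦ ⟨y, Tx⟩ is continuous on D(T)}` and `⟨y, Tx⟩ = ⟨Sy, x⟩` there. -/
def QOp.IsAdjointOf (T S : QOp) : Prop :=
  S.dom = {y | ContinuousOn (fun x => qinner y (T.app x)) T.dom} ∧
  ∀ y ∈ S.dom, ∀ x ∈ T.dom, qinner y (T.app x) = qinner (S.app y) x

/-- Composition `S ∘ T` of partial operators, with the natural domain. -/
def QOp.comp (S T : QOp) : QOp :=
  ⟨{x ∈ T.dom | T.app x ∈ S.dom}, fun x => S.app (T.app x)⟩

/-- Equality of partial operators: equal domains and equal values on the domain. -/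
def QOp.Eq (A B : QOp) : Prop := A.dom = B.dom ∧ ∀ x ∈ A.dom, A.app x = B.app x

/-- `T` is normal: `T*T = TT*` (including equality of the domains). -/
def QOp.IsNormal (T : QOp) : Prop :=
  ∃ S : QOp, T.IsAdjointOf S ∧ QOp.Eq (S.comp T) (T.comp S)

/-- `T` is compact (as an operator on the subspace `S` of `H`): the image of the
closed unit ball of `S` is relatively compact. -/
def IsCompactOn (T : Hsp → Hsp) (S : Set Hsp) : Prop :=
  IsCompact (closure (T '' (Metric.closedBall 0 1 ∩ S)))

/-- `T` has squared Hilbert–Schmidt norm `v` on the subspace `S`: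
`∑ᵣ ‖T eᵣ‖² = v` for some orthonormal basis `e` of `S`. -/
def HasHSNormSqOn (T : Hsp → Hsp) (S : Set Hsp) (v : ℝ) : Prop :=
  ∃ e : ℕ → Hsp, IsONBasisOn S e ∧ HasSum (fun r => ‖T (e r)‖ ^ 2) v

/-- `T` is diagonal: there are an orthonormal basis `{φᵣ}` of `H` contained in `D(T)`
and quaternions `qᵣ` with `Tφᵣ = φᵣ qᵣ`. -/
def QOp.IsDiagonal (T : QOp) : Prop :=
  ∃ e : ℕ → Hsp, IsONBasisOn Set.univ e ∧ (∀ r, e r ∈ T.dom) ∧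
    ∃ q : ℕ → Hq, ∀ r, T.app (e r) = rsmul (q r) (e r)

/-- The operator `Δ_q(N) = N² - N(q + q̄) + I|q|²` for a bounded operator `N`. -/
def sphDeltaB (N : Hsp → Hsp) (q : Hq) : Hsp → Hsp :=
  fun x => N (N x) - rsmul (q + star q) (N x) + rsmul ((normSq q : ℝ) : Hq) x

/-- `q` lies in the spherical resolvent of the bounded operator `N`. -/
def inSphResolventB (N : Hsp → Hsp) (q : Hq) : Prop :=
  (∀ x, sphDeltaB N q x = 0 → x = 0) ∧
  Dense (Set.range (sphDeltaB N q)) ∧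
  ∃ M : ℝ, ∀ x, ‖x‖ ≤ M * ‖sphDeltaB N q x‖

/-- The spherical spectrum of a bounded operator. -/
def sphSpectrumB (N : Hsp → Hsp) : Set Hq := {q | ¬ inSphResolventB N q}

/-- The domain `D(N²)` of the square of a partial operator. -/
def QOp.sqDom (N : QOp) : Set Hsp := {x ∈ N.dom | N.app x ∈ N.dom}

/-- The map underlying `Δ_q(N) = N² - N(q + q̄) + I|q|²`, defined on `D(N²)`. -/
def sphDeltaU (N : QOp) (q : Hq) : Hsp → Hsp :=
  fun x => N.app (N.app x) - rsmul (q + star q) (N.app x) + rsmul ((normSq q : ℝ) : Hq) x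

/-- `q` lies in the spherical resolvent of the operator `N ∈ C(H)`. -/
def inSphResolventU (N : QOp) (q : Hq) : Prop :=
  (∀ x ∈ N.sqDom, sphDeltaU N q x = 0 → x = 0) ∧
  Dense (sphDeltaU N q '' N.sqDom) ∧
  ∃ M : ℝ, ∀ x ∈ N.sqDom, ‖x‖ ≤ M * ‖sphDeltaU N q x‖

/-- The spherical spectrum of `N ∈ C(H)`. -/
def sphSpectrumU (N : QOp) : Set Hq := {q | ¬ inSphResolventU N q}

/-- The circularization `Ω_K = {α + jβ : α + mβ ∈ K, j ∈ 𝕊}` of `K ⊆ ℂ_m`. -/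
def circ (m : Hq) (K : Set Hq) : Set Hq :=
  {p | ∃ α β : ℝ, ∃ j ∈ QS, ((α : Hq) + m * (β : Hq) ∈ K) ∧ p = (α : Hq) + j * (β : Hq)}

/-! ### Right scalar multiplication and the quaternionic inner product -/

theorem rsmul_apply (q : Hq) (x : Hsp) (n : ℕ) : rsmul q x n = x n * q := rfl

theorem rsmul_rsmul (p q : Hq) (x : Hsp) : rsmul p (rsmul q x) = rsmul (q * p) x :=
  smul_smul _ _ _

theorem rsmul_add (q : Hq) (x y : Hsp) : rsmul q (x + y) = rsmul q x + rsmul q y :=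
  smul_add _ _ _

theorem rsmul_sub (q : Hq) (x y : Hsp) : rsmul q (x - y) = rsmul q x - rsmul q y :=
  smul_sub _ _ _

theorem rsmul_neg (q : Hq) (x : Hsp) : rsmul q (-x) = -rsmul q x :=
  smul_neg _ _

theorem add_rsmul (p q : Hq) (x : Hsp) : rsmul (p + q) x = rsmul p x + rsmul q x :=
  add_smul _ _ _

theorem neg_rsmul (q : Hq) (x : Hsp) : rsmul (-q) x = -rsmul q x :=
  neg_smul _ _

theorem one_rsmul (x : Hsp) : rsmul 1 x = x :=
  one_smul _ _

theorem rsmul_coe (r : ℝ) (x : Hsp) : rsmul (r : Hq) x = r • x := by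
  ext n : 2
  rw [rsmul_apply, lp.coeFn_smul, Pi.smul_apply, Quaternion.mul_coe_eq_smul]

theorem continuous_rsmul (q : Hq) : Continuous (rsmul q) :=
  continuous_const_smul (MulOpposite.op q)

theorem norm_rsmul_le (q : Hq) (x : Hsp) : ‖rsmul q x‖ ≤ ‖q‖ * ‖x‖ :=
  norm_smul_le (MulOpposite.op q) x

theorem summable_qinner (x y : Hsp) : Summable fun n => star (x n) * y n := by
  refine Summable.of_norm ?_
  have h := lp.summable_mul (p := 2) (q := 2) (by norm_num [Real.holderConjugate_iff]) x y
  simpa [norm_mul, Quaternion.norm_star] using h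

theorem hasSum_qinner (x y : Hsp) : HasSum (fun n => star (x n) * y n) (qinner x y) :=
  (summable_qinner x y).hasSum

theorem qinner_add_right (x y z : Hsp) : qinner x (y + z) = qinner x y + qinner x z := by
  refine HasSum.unique (hasSum_qinner x (y + z)) ?_
  simpa [mul_add] using (hasSum_qinner x y).add (hasSum_qinner x z)

theorem qinner_rsmul_right (q : Hq) (x y : Hsp) : qinner x (rsmul q y) = qinner x y * q := by
  refine HasSum.unique (hasSum_qinner x (rsmul q y)) ?_
  simpa [rsmul_apply, mul_assoc] using (hasSum_qinner x y).mul_right q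

theorem star_qinner (x y : Hsp) : star (qinner x y) = qinner y x := by
  refine HasSum.unique ?_ (hasSum_qinner y x)
  simpa using (hasSum_qinner x y).star

theorem qinner_add_left (x y z : Hsp) : qinner (x + y) z = qinner x z + qinner y z := by
  rw [← star_qinner, qinner_add_right, star_add, star_qinner, star_qinner]

theorem qinner_rsmul_left (q : Hq) (x y : Hsp) :
    qinner (rsmul q x) y = star q * qinner x y := by
  rw [← star_qinner, qinner_rsmul_right, star_mul, star_qinner]

theorem qinner_neg_left (x y : Hsp) : qinner (-x) y = -qinner x y := by
  have h := qinner_rsmul_left (-1) x y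
  rwa [neg_rsmul, one_rsmul, star_neg, star_one, neg_one_mul] at h

theorem re_qinner (x y : Hsp) : (qinner x y).re = inner ℝ x y := by
  have h : HasSum (fun n => (star (x n) * y n).re) (qinner x y).re :=
    (hasSum_qinner x y).map (AddMonoidHom.mk' (fun q : Hq => q.re) Quaternion.re_add)
      Quaternion.continuous_re
  have hinner : (fun n => (star (x n) * y n).re) = fun n => inner ℝ (x n) (y n) := by
    funext n
    simp only [Quaternion.inner_def, Quaternion.re_mul, Quaternion.re_star, Quaternion.imI_star,
      Quaternion.imJ_star, Quaternion.imK_star]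
    ring
  rw [hinner] at h
  exact h.unique (lp.hasSum_inner x y)

theorem re_qinner_self (x : Hsp) : (qinner x x).re = ‖x‖ ^ 2 := by
  rw [re_qinner, real_inner_self_eq_norm_sq]

theorem eq_of_forall_qinner_eq {x y : Hsp} (h : ∀ z, qinner x z = qinner y z) : x = y :=
  ext_inner_right ℝ fun z => by rw [← re_qinner, ← re_qinner, h]

theorem qinner_single (x : Hsp) (n : ℕ) :
    qinner x (lp.single 2 n (1 : Hq)) = star (x n) := by
  refine HasSum.unique (hasSum_qinner _ _) ?_
  convert hasSum_ite_eq n (star (x n)) using 2 with k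
  by_cases hk : k = n
  · subst hk; simp
  · simp [hk]

theorem Quaternion.eq_of_forall_re_mul_eq {a b : Hq} (h : ∀ q, (a * q).re = (b * q).re) :
    a = b := by
  have h1 := h (star (a - b))
  rw [← sub_eq_zero, ← Quaternion.normSq_eq_zero, ← Quaternion.inner_self,
    Quaternion.inner_def, sub_mul, Quaternion.re_sub, h1, sub_self]

/-! ### Independence of the Hilbert–Schmidt norm from the basis -/

theorem hasSum_normSq_qinner {ι : Type*} {e : ι → Hsp} {x : Hsp}
    (h : HasSum (fun r => rsmul (qinner (e r) x) (e r)) x) :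
    HasSum (fun r => ‖qinner (e r) x‖ ^ 2) (‖x‖ ^ 2) := by
  have h1 := h.mapL (innerSL ℝ x)
  have hterm (r : ι) : innerSL ℝ x (rsmul (qinner (e r) x) (e r)) = ‖qinner (e r) x‖ ^ 2 := by
    rw [innerSL_apply_apply, ← re_qinner, qinner_rsmul_right, ← star_qinner (e r) x,
      Quaternion.star_mul_self, Quaternion.re_coe, Quaternion.normSq_eq_norm_mul_self, sq]
  simpa only [hterm, innerSL_apply_apply, real_inner_self_eq_norm_sq] using h1

namespace IsBoundedRightLinear

variable {T : Hsp → Hsp}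

theorem map_smul_real (hT : IsBoundedRightLinear T) (r : ℝ) (x : Hsp) :
    T (r • x) = r • T x := by
  rw [← rsmul_coe, hT.2.1, rsmul_coe]

/-- A bounded right linear operator, as a real continuous linear map. -/
def toCLM (hT : IsBoundedRightLinear T) : Hsp →L[ℝ] Hsp :=
  LinearMap.mkContinuousOfExistsBound
    { toFun := T, map_add' := hT.1, map_smul' := hT.map_smul_real } hT.2.2

theorem toCLM_apply (hT : IsBoundedRightLinear T) (x : Hsp) : hT.toCLM x = T x := rfl

theorem exists_adjointOf (hT : IsBoundedRightLinear T) : ∃ S, AdjointOf T S := by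
  refine ⟨ContinuousLinearMap.adjoint hT.toCLM, fun x y => ?_⟩
  refine Quaternion.eq_of_forall_re_mul_eq fun q => ?_
  rw [← qinner_rsmul_right, ← qinner_rsmul_right, re_qinner, re_qinner,
    ContinuousLinearMap.adjoint_inner_left, toCLM_apply, hT.2.1]

end IsBoundedRightLinear

theorem AdjointOf.tsum_enorm_sq_eq {T S : Hsp → Hsp} (hS : AdjointOf T S) {e f : ℕ → Hsp}
    (he : IsONBasisOn Set.univ e) (hf : IsONBasisOn Set.univ f) :
    ∑' r, ‖T (e r)‖ₑ ^ 2 = ∑' r, ‖S (f r)‖ₑ ^ 2 := by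
  have parseval {e : ℕ → Hsp} (he : IsONBasisOn Set.univ e) (x : Hsp) :
      ‖x‖ₑ ^ 2 = ∑' r, ‖qinner (e r) x‖ₑ ^ 2 := by
    have h := hasSum_normSq_qinner (he.2.2 x (Set.mem_univ x))
    have := ENNReal.ofReal_tsum_of_nonneg (fun r => by positivity) h.summable
    simpa [h.tsum_eq, ENNReal.ofReal_pow] using this
  calc ∑' r, ‖T (e r)‖ₑ ^ 2 = ∑' r, ∑' s, ‖qinner (f s) (T (e r))‖ₑ ^ 2 :=
        tsum_congr fun r => parseval hf _
    _ = ∑' s, ∑' r, ‖qinner (e r) (S (f s))‖ₑ ^ 2 := by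
        rw [ENNReal.tsum_comm]
        refine tsum_congr fun s => tsum_congr fun r => ?_
        rw [hS, ← star_qinner, ← ofReal_norm, ← ofReal_norm, Quaternion.norm_star]
    _ = ∑' r, ‖S (f r)‖ₑ ^ 2 := tsum_congr fun s => (parseval he _).symm

theorem IsBoundedRightLinear.tsum_enorm_sq_eq {T : Hsp → Hsp} (hT : IsBoundedRightLinear T)
    {e f : ℕ → Hsp} (he : IsONBasisOn Set.univ e) (hf : IsONBasisOn Set.univ f) :
    ∑' r, ‖T (e r)‖ₑ ^ 2 = ∑' r, ‖T (f r)‖ₑ ^ 2 := by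
  obtain ⟨S, hS⟩ := hT.exists_adjointOf
  rw [hS.tsum_enorm_sq_eq he hf, hS.tsum_enorm_sq_eq hf hf]

theorem hasSum_sq_norm_iff {E : Type*} [SeminormedAddCommGroup E] {f : ℕ → E} {v : ℝ} :
    HasSum (fun r => ‖f r‖ ^ 2) v ↔ 0 ≤ v ∧ ∑' r, ‖f r‖ₑ ^ 2 = ENNReal.ofReal v := by
  have hof (r : ℕ) : ‖f r‖ₑ ^ 2 = ENNReal.ofReal (‖f r‖ ^ 2) := by
    rw [ENNReal.ofReal_pow (norm_nonneg _), ofReal_norm]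
  simp_rw [hof]
  constructor
  · intro h
    have h0 := h.nonneg fun r => by positivity
    exact ⟨h0, by rw [← ENNReal.ofReal_tsum_of_nonneg (fun r => by positivity) h.summable,
      h.tsum_eq]⟩
  · rintro ⟨h0, h⟩
    have hs : Summable fun r => ‖f r‖ ^ 2 := by
      have := ENNReal.summable_toReal (h.trans_ne ENNReal.ofReal_ne_top)
      simpa using this
    rw [← ENNReal.ofReal_tsum_of_nonneg (fun r => by positivity) hs,
      ENNReal.ofReal_eq_ofReal_iff (tsum_nonneg fun r => by positivity) h0] at h
    exact h ▸ hs.hasSum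

theorem IsBoundedRightLinear.hasSum_iff {T : Hsp → Hsp} (hT : IsBoundedRightLinear T)
    {e f : ℕ → Hsp} (he : IsONBasisOn Set.univ e) (hf : IsONBasisOn Set.univ f) {v : ℝ} :
    HasSum (fun r => ‖T (e r)‖ ^ 2) v ↔ HasSum (fun r => ‖T (f r)‖ ^ 2) v := by
  rw [hasSum_sq_norm_iff, hasSum_sq_norm_iff, hT.tsum_enorm_sq_eq he hf]

/-! ### The splitting of `H` induced by an anti self-adjoint unitary operator -/

theorem QS.mul_self {m : Hq} (hm : m ∈ QS) : m * m = -1 := by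
  have h := Quaternion.star_mul_self m
  rw [hm.1, Quaternion.normSq_eq_norm_mul_self, hm.2, mul_one, Quaternion.coe_one, neg_mul] at h
  rw [← h, neg_neg]

theorem QS.re_eq_zero {m : Hq} (hm : m ∈ QS) : m.re = 0 := by
  have h := congrArg (·.re) hm.1
  simp only [Quaternion.re_star, Quaternion.re_neg] at h
  linarith

theorem QS.sq_add_sq_add_sq {m : Hq} (hm : m ∈ QS) :
    m.imI ^ 2 + m.imJ ^ 2 + m.imK ^ 2 = 1 := by
  have h := Quaternion.normSq_eq_norm_mul_self m
  rw [Quaternion.normSq_def', QS.re_eq_zero hm, hm.2] at h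
  linarith

theorem QS.exists_anticommute {m : Hq} (hm : m ∈ QS) : ∃ p : Hq, p ≠ 0 ∧ m * p = -(p * m) := by
  have hmm := QS.mul_self hm
  by_contra! H
  have hcomm (q : Hq) : m * q = q * m := by
    by_contra hq
    refine H (m * q - q * m) (sub_ne_zero.2 hq) ?_
    rw [mul_sub, sub_mul, ← mul_assoc, hmm, mul_assoc q, hmm, mul_assoc]
    noncomm_ring
  have hJ (q : Hq) := congrArg (·.imJ) (hcomm q)
  have hK (q : Hq) := congrArg (·.imK) (hcomm q)
  simp only [Quaternion.imJ_mul, Quaternion.imK_mul] at hJ hK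
  have h1 := hJ ⟨0, 1, 0, 0⟩
  have h2 := hK ⟨0, 1, 0, 0⟩
  have h3 := hK ⟨0, 0, 1, 0⟩
  ring_nf at h1 h2 h3
  have h := QS.sq_add_sq_add_sq hm
  rw [show m.imI = 0 by linarith, show m.imJ = 0 by linarith, show m.imK = 0 by linarith] at h
  norm_num at h

theorem IsAntiSelfAdjoint.apply_apply {J : Hsp → Hsp} (hJa : IsAntiSelfAdjoint J)
    (hJu : IsUnitaryOp J) (x : Hsp) : J (J x) = -x := by
  obtain ⟨S, hS, hSJ, -⟩ := hJu
  have hSJ' (y : Hsp) : S y = -J y := eq_of_forall_qinner_eq fun z => by rw [← hS, hJa]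
  rw [← neg_eq_iff_eq_neg, ← hSJ', hSJ]

theorem qinner_commute_of_mem_Hplus {J : Hsp → Hsp} {m : Hq} (hm : m ∈ QS)
    (hJa : IsAntiSelfAdjoint J) {x y : Hsp} (hx : x ∈ Hplus J m) (hy : y ∈ Hplus J m) :
    m * qinner x y = qinner x y * m := by
  have h : qinner x (J y) = qinner (-J x) y := hJa y x
  rw [show J y = rsmul m y from hy, show J x = rsmul m x from hx, qinner_rsmul_right,
    qinner_neg_left, qinner_rsmul_left, hm.1] at h
  rw [h, neg_mul, neg_neg]

theorem exists_eq_add_rsmul_of_Hplus {J : Hsp → Hsp} {m p : Hq} (hm : m ∈ QS) (hp : p ≠ 0)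
    (hmp : m * p = -(p * m)) (hJlin : IsBoundedRightLinear J)
    (hJJ : ∀ x, J (J x) = -x) (x : Hsp) :
    ∃ a ∈ Hplus J m, ∃ b ∈ Hplus J m, x = a + rsmul p b := by
  have hmm := QS.mul_self hm
  have hmp' : p⁻¹ * m = -(m * p⁻¹) := by
    have h : p⁻¹ * (m * p) * p⁻¹ = p⁻¹ * -(p * m) * p⁻¹ := by rw [hmp]
    rw [mul_neg, inv_mul_cancel_left₀ hp, ← mul_assoc, mul_inv_cancel_right₀ hp] at h
    rw [h, neg_mul]
  have hneg (x : Hsp) : J (-x) = -J x := by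
    rw [← one_rsmul x, ← neg_rsmul, hJlin.2.1, neg_rsmul, one_rsmul, one_rsmul]
  have hsub (x y : Hsp) : J (x - y) = J x - J y := by
    rw [sub_eq_add_neg, hJlin.1, hneg, sub_eq_add_neg]
  refine ⟨(2⁻¹ : ℝ) • (x - rsmul m (J x)), ?_,
    (2⁻¹ : ℝ) • rsmul p⁻¹ (x + rsmul m (J x)), ?_, ?_⟩
  · show J _ = rsmul m _
    rw [← rsmul_coe, hJlin.2.1, hsub, hJlin.2.1, hJJ, rsmul_rsmul, Quaternion.coe_commutes,
      ← rsmul_rsmul, rsmul_sub m, rsmul_rsmul m m, hmm, neg_rsmul, one_rsmul, rsmul_neg]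
    congr 1
    abel
  · show J _ = rsmul m _
    rw [← rsmul_coe, hJlin.2.1, hJlin.2.1, hJlin.1, hJlin.2.1, hJJ, rsmul_rsmul m,
      Quaternion.coe_commutes, ← rsmul_rsmul, rsmul_rsmul m p⁻¹, hmp', neg_rsmul,
      ← rsmul_rsmul, rsmul_add m, rsmul_rsmul m m, hmm, neg_rsmul, one_rsmul, rsmul_neg m x,
      ← rsmul_neg p⁻¹]
    congr 2
    abel
  · rw [← rsmul_coe _ (rsmul _ _), rsmul_rsmul p, Quaternion.coe_commutes, ← rsmul_rsmul,
      rsmul_rsmul p, inv_mul_cancel₀ hp, one_rsmul, rsmul_coe, ← smul_add,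
      sub_add_add_cancel, ← two_smul ℝ x, smul_smul, inv_mul_cancel₀ two_ne_zero, one_smul]

theorem hasSum_of_hasSum_Hplus {J : Hsp → Hsp} {m : Hq} (hm : m ∈ QS)
    (hJlin : IsBoundedRightLinear J) (hJJ : ∀ x, J (J x) = -x) {ι : Type*} {e : ι → Hsp}
    (he : ∀ x ∈ Hplus J m, HasSum (fun r => rsmul (qinner (e r) x) (e r)) x) (x : Hsp) :
    HasSum (fun r => rsmul (qinner (e r) x) (e r)) x := by
  obtain ⟨p, hp, hmp⟩ := QS.exists_anticommute hm
  obtain ⟨a, ha, b, hb, rfl⟩ := exists_eq_add_rsmul_of_Hplus hm hp hmp hJlin hJJ x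
  have hb' : HasSum (fun r => rsmul p (rsmul (qinner (e r) b) (e r))) (rsmul p b) :=
    (he b hb).map (DistribSMul.toAddMonoidHom Hsp (MulOpposite.op p)) (continuous_rsmul p)
  convert (he a ha).add hb' using 2 with r
  rw [qinner_add_right, add_rsmul, qinner_rsmul_right, ← rsmul_rsmul]

theorem IsONBasisOn.univ_of_Hplus {J : Hsp → Hsp} {m : Hq} (hm : m ∈ QS)
    (hJlin : IsBoundedRightLinear J) (hJJ : ∀ x, J (J x) = -x) {e : ℕ → Hsp}
    (he : IsONBasisOn (Hplus J m) e) : IsONBasisOn Set.univ e :=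
  ⟨fun _ => Set.mem_univ _, he.2.1, fun x _ => hasSum_of_hasSum_Hplus hm hJlin hJJ he.2.2 x⟩

/-! ### Cardinality of orthonormal bases -/

theorem countable_of_hasSum_expansion {ι : Type*} {e : ι → Hsp} (he0 : ∀ r, e r ≠ 0)
    (he : ∀ x, HasSum (fun r => rsmul (qinner (e r) x) (e r)) x) : Countable ι := by
  have hcount (n : ℕ) :=
    (hasSum_normSq_qinner (he (lp.single 2 n (1 : Hq)))).summable.countable_support
  rw [← Set.countable_univ_iff]
  refine (Set.countable_iUnion hcount).mono fun r _ => ?_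
  obtain ⟨n, hn⟩ : ∃ n, e r n ≠ 0 := by
    by_contra! H
    exact he0 r (lp.ext (funext H))
  refine Set.mem_iUnion.2 ⟨n, ?_⟩
  simpa [qinner_single] using hn

theorem not_finite_Hsp : ¬ Module.Finite ℝ Hsp := by
  intro h
  have hli : LinearIndependent ℝ fun n : ℕ => (lp.single 2 n (1 : Hq) : Hsp) := by
    refine Orthonormal.linearIndependent ⟨fun n => ?_, fun i j hij => ?_⟩
    · rw [lp.norm_single (by norm_num), norm_one]
    · refine (lp.inner_single_left (𝕜 := ℝ) (G := fun _ : ℕ => Hq) i 1 (lp.single 2 j 1)).trans ?_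
      rw [lp.single_apply_ne _ _ _ hij, inner_zero_right]
  exact not_finite_iff_infinite.2 inferInstance hli.finite

theorem infinite_of_hasSum_expansion {ι : Type*} {e : ι → Hsp}
    (he : ∀ x, HasSum (fun r => rsmul (qinner (e r) x) (e r)) x) : Infinite ι := by
  by_contra hfin
  rw [not_infinite_iff_finite] at hfin
  have := Fintype.ofFinite ι
  let L : (ι → Hq) →ₗ[ℝ] Hsp :=
    { toFun := fun c => ∑ r, rsmul (c r) (e r)
      map_add' := fun c d => by simp [add_rsmul, Finset.sum_add_distrib]
      map_smul' := fun a c => by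
        rw [Finset.smul_sum]
        refine Finset.sum_congr rfl fun r _ => ?_
        rw [← rsmul_coe, rsmul_rsmul, Quaternion.mul_coe_eq_smul, Pi.smul_apply, RingHom.id_apply] }
  refine not_finite_Hsp (Module.Finite.of_surjective L fun x => ?_)
  exact ⟨fun r => qinner (e r) x, (hasSum_fintype _).unique (he x)⟩

/-! ### Orthonormal bases of the slice Hilbert space -/

/-- The component in `ℂ_m ≅ ℂ` of a quaternion, for `m ∈ 𝕊`. -/
def slicePart (m q : Hq) : ℂ := ⟨q.re, -(m * q).re⟩

/-- The embedding `α + iβ ↦ α + mβ` of `ℂ` onto `ℂ_m`. -/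
def sliceEmb {m : Hq} (hm : m ∈ QS) : ℂ →ₐ[ℝ] Hq := Complex.liftAux m (QS.mul_self hm)

theorem sliceEmb_apply {m : Hq} (hm : m ∈ QS) (z : ℂ) :
    sliceEmb hm z = (z.re : Hq) + z.im • m := rfl

theorem norm_sliceEmb {m : Hq} (hm : m ∈ QS) (z : ℂ) : ‖sliceEmb hm z‖ = ‖z‖ := by
  have h1 := QS.sq_add_sq_add_sq hm
  rw [← sq_eq_sq₀ (norm_nonneg _) (norm_nonneg _), Complex.sq_norm, Complex.normSq_apply, sq,
    ← Quaternion.normSq_eq_norm_mul_self, Quaternion.normSq_def', sliceEmb_apply]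
  simp [QS.re_eq_zero hm]
  linear_combination z.im ^ 2 * h1

theorem slicePart_star_sliceEmb_mul {m : Hq} (hm : m ∈ QS) (z : ℂ) (q : Hq) :
    slicePart m (star (sliceEmb hm z) * q) = starRingEnd ℂ z * slicePart m q := by
  have h0 := QS.re_eq_zero hm
  have h1 := QS.sq_add_sq_add_sq hm
  rw [sliceEmb_apply]
  apply Complex.ext
  · simp [slicePart, h0]
    ring
  · simp [slicePart, h0]
    linear_combination (- z.im * q.re) * h1

theorem conj_slicePart {m : Hq} (hm : m ∈ QS) (q : Hq) :
    starRingEnd ℂ (slicePart m q) = slicePart m (star q) := by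
  have h0 := QS.re_eq_zero hm
  apply Complex.ext
  · simp [slicePart]
  · simp [slicePart, h0]
    ring

theorem sliceEmb_slicePart {m : Hq} (hm : m ∈ QS) {q : Hq} (hq : m * q = q * m) :
    sliceEmb hm (slicePart m q) = q := by
  have h0 := QS.re_eq_zero hm
  have h := QS.sq_add_sq_add_sq hm
  have h1 := congrArg (·.imI) hq
  have h2 := congrArg (·.imJ) hq
  have h3 := congrArg (·.imK) hq
  simp [h0] at h1 h2 h3
  rw [sliceEmb_apply]
  ext
  · simp [slicePart, h0]
  · simp [slicePart, h0]
    linear_combination q.imI * h + m.imJ / 2 * h3 - m.imK / 2 * h2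
  · simp [slicePart, h0]
    linear_combination q.imJ * h + m.imK / 2 * h1 - m.imI / 2 * h3
  · simp [slicePart, h0]
    linear_combination q.imK * h + m.imI / 2 * h2 - m.imJ / 2 * h1

/-- The complex Hilbert space structure on `H` in which `i` acts as right multiplication by
`m ∈ 𝕊`. -/
@[reducible] def sliceInnerProductSpace {m : Hq} (hm : m ∈ QS) : InnerProductSpace ℂ Hsp :=
  letI : Module ℂ Hsp := Module.compHom Hsp
    ((sliceEmb hm : ℂ →+* Hq).toOpposite fun z w => by
      show _ * _ = _ * _
      rw [← map_mul, ← map_mul, mul_comm])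
  { norm_smul_le := fun z x => (norm_rsmul_le (sliceEmb hm z) x).trans_eq (by rw [norm_sliceEmb])
    inner := fun x y => slicePart m (qinner x y)
    norm_sq_eq_re_inner := fun x => (re_qinner_self x).symm
    conj_inner_symm := fun x y => by rw [conj_slicePart hm, star_qinner]
    add_left := fun x y z => by
      rw [qinner_add_left]
      apply Complex.ext
      · simp [slicePart]
      · simp only [slicePart, mul_add, Quaternion.re_add, Complex.add_im]
        ring
    smul_left := fun x y z => by
      rw [← slicePart_star_sliceEmb_mul hm, ← qinner_rsmul_left]
      rfl }

theorem exists_isONBasisOn_Hplus {J : Hsp → Hsp} {m : Hq} (hm : m ∈ QS)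
    (hJlin : IsBoundedRightLinear J) (hJa : IsAntiSelfAdjoint J)
    (hJJ : ∀ x, J (J x) = -x) : ∃ e, IsONBasisOn (Hplus J m) e := by
  classical
  let := sliceInnerProductSpace hm
  have hsmul (z : ℂ) (x : Hsp) : z • x = rsmul (sliceEmb hm z) x := rfl
  have hinner (x y : Hsp) : inner ℂ x y = slicePart m (qinner x y) := rfl
  let K : Submodule ℂ Hsp :=
    { carrier := Hplus J m
      add_mem' := fun {x y} (hx : J x = _) (hy : J y = _) => by
        show J _ = rsmul m _
        rw [hJlin.1, hx, hy, rsmul_add]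
      zero_mem' := by
        show J _ = rsmul m _
        exact (map_zero hJlin.toCLM).trans (smul_zero _).symm
      smul_mem' := fun z x (hx : J x = _) => by
        show J _ = rsmul m _
        have : sliceEmb hm z * m = m * sliceEmb hm z := by
          simp [sliceEmb_apply, add_mul, mul_add, Quaternion.coe_commutes]
        rw [hsmul, hJlin.2.1, hx, rsmul_rsmul, rsmul_rsmul, this] }
  have hclosed : IsClosed (K : Set Hsp) := isClosed_eq hJlin.toCLM.continuous (continuous_rsmul m)
  have : CompleteSpace K := hclosed.completeSpace_coe
  obtain ⟨w, b, -⟩ := exists_hilbertBasis ℂ K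
  have hemb {x y : Hsp} (hx : x ∈ Hplus J m) (hy : y ∈ Hplus J m) :
      sliceEmb hm (inner ℂ x y) = qinner x y := by
    rw [hinner, sliceEmb_slicePart hm (qinner_commute_of_mem_Hplus hm hJa hx hy)]
  have hexp : ∀ x ∈ Hplus J m, HasSum (fun r => rsmul (qinner (b r : Hsp) x) (b r : Hsp)) x := by
    intro x hx
    have h : HasSum (fun r => ((b.repr ⟨x, hx⟩ r • b r : K) : Hsp)) x :=
      (b.hasSum_repr ⟨x, hx⟩).mapL K.subtypeL
    convert h using 2 with r
    rw [b.repr_apply_apply, ← hemb (b r).2 hx]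
    rfl
  have hexp' := hasSum_of_hasSum_Hplus hm hJlin hJJ hexp
  have : Countable w := countable_of_hasSum_expansion
    (fun r h => b.orthonormal.ne_zero r (Subtype.ext h)) hexp'
  have : Infinite w := infinite_of_hasSum_expansion hexp'
  obtain ⟨_⟩ := nonempty_denumerable w
  let g : ℕ ≃ w := (Denumerable.eqv w).symm
  refine ⟨fun r => b (g r), fun r => (b (g r)).2, fun r s => ?_, fun x hx => ?_⟩
  · have h := orthonormal_iff_ite.1 b.orthonormal (g r) (g s)
    rw [← hemb (b (g r)).2 (b (g s)).2, ← Submodule.coe_inner, h]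
    simp only [g.apply_eq_iff_eq]
    split_ifs <;> simp
  · exact (Equiv.hasSum_iff g (f := fun r : w => rsmul (qinner (b r : Hsp) x) (b r : Hsp))).2
      (hexp x hx)

/-- For `T ∈ B(H)` commuting with `J`, `T` is Hilbert–Schmidt on `H`
iff the restriction `T₊` is Hilbert–Schmidt on `H₊^{Jm}`, with equal Hilbert–Schmidt
norms (`‖T‖₂² = ‖T₊‖₂²`, over some—equivalently any—orthonormal basis). -/
theorem hilbertSchmidt_iff_slice_restriction (J : Hsp → Hsp) (m : Hq) (hm : m ∈ QS)
    (hJlin : IsBoundedRightLinear J) (hJa : IsAntiSelfAdjoint J) (hJu : IsUnitaryOp J)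
    (T : Hsp → Hsp) (hT : IsBoundedRightLinear T)
    (hcomm : ∀ x, T (J x) = J (T x)) :
    ((∃ v : ℝ, HasHSNormSqOn T Set.univ v) ↔ (∃ v : ℝ, HasHSNormSqOn T (Hplus J m) v)) ∧
    (∀ v : ℝ, HasHSNormSqOn T Set.univ v ↔ HasHSNormSqOn T (Hplus J m) v) := by
  have hJJ := hJa.apply_apply hJu
  have key (v : ℝ) : HasHSNormSqOn T Set.univ v ↔ HasHSNormSqOn T (Hplus J m) v := by
    constructor
    · rintro ⟨f, hf, hv⟩
      obtain ⟨e, he⟩ := exists_isONBasisOn_Hplus hm hJlin hJa hJJ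
      exact ⟨e, he, (hT.hasSum_iff hf (he.univ_of_Hplus hm hJlin hJJ)).1 hv⟩
    · rintro ⟨e, he, hv⟩
      exact ⟨e, he.univ_of_Hplus hm hJlin hJJ, hv⟩
  exact ⟨exists_congr key, key⟩
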